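/- arXiv:math/0209216 — 3 statements merged into one kernel-verified Lean document; each statement's English description precedes it below -/
import Mathlib

section
/- Let R, I, M be as in the context, and suppose M_x and M_y are finitely generated over R_x and R_y respectively. Then M_{x+y} is a finitely generated R_{x+y}-module. -/
open CategoryTheory

noncomputable section

universe u

/-- The Krull dimension of a module: `dim R/ann(M)`. -/
def moduleDim (R : Type u) [CommRing R] (M : Type*) [AddCommGroup M] [Module R M] :
    WithBot (WithTop ℕ) :=
  ringKrullDim (R ⧸ Module.annihilator R M)

/-- The depth of `M` with respect to an ideal `J`: the supremum of the lengths of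
`M`-regular sequences consisting of elements of `J`. -/
def moduleDepth (R : Type u) [CommRing R] (J : Ideal R) (M : Type*) [AddCommGroup M]
    [Module R M] : ℕ∞ :=
  sSup {n : ℕ∞ | ∃ rs : List R, (rs.length : ℕ∞) = n ∧ (∀ r ∈ rs, r ∈ J) ∧
    RingTheory.Sequence.IsRegular M rs}

/-- Serre's condition `S_ℓ` : for every prime `p` in the support of `M`,
`depth M_p ≥ min (ℓ, dim M_p)`. -/
def SerreCondition (R : Type u) [CommRing R] (ℓ : ℕ) (M : Type u) [AddCommGroup M]
    [Module R M] : Prop :=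
  ∀ p ∈ Module.support R M,
    min ((ℓ : ℕ∞) : WithBot ℕ∞)
        (moduleDim (Localization.AtPrime p.asIdeal) (LocalizedModule p.asIdeal.primeCompl M)) ≤
      ((moduleDepth (Localization.AtPrime p.asIdeal)
          (IsLocalRing.maximalIdeal (Localization.AtPrime p.asIdeal))
          (LocalizedModule p.asIdeal.primeCompl M) : ℕ∞) : WithBot ℕ∞)

/-- A module `N` over `S` is `J`-cofinite if its support is contained in `V(J)` and all the
modules `Ext^i_S(S/J, N)` are finitely generated. -/
def IsCofinite (S : Type u) [CommRing S] (J : Ideal S) (N : ModuleCat.{u} S) : Prop :=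
  Module.support S N ⊆ PrimeSpectrum.zeroLocus (J : Set S) ∧
  ∀ i : ℕ, Module.Finite S
    (((Ext S (ModuleCat.{u} S) i).obj (Opposite.op (ModuleCat.of S (S ⧸ J)))).obj N)

/-- A ring is catenary if any two saturated chains of primes with the same endpoints have
the same length. -/
def IsCatenaryRing (R : Type u) [CommRing R] : Prop :=
  ∀ c₁ c₂ : LTSeries (PrimeSpectrum R),
    c₁.head = c₂.head → c₁.last = c₂.last →
    (∀ i : Fin c₁.length, c₁.toFun i.castSucc ⋖ c₁.toFun i.succ) →
    (∀ i : Fin c₂.length, c₂.toFun i.castSucc ⋖ c₂.toFun i.succ) →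
    c₁.length = c₂.length

/-- A module is indecomposable if it is nonzero and is not the internal direct sum of two
nonzero submodules. -/
def ModuleIndecomposable (R : Type u) [CommRing R] (M : Type*) [AddCommGroup M]
    [Module R M] : Prop :=
  Nontrivial M ∧ ∀ N₁ N₂ : Submodule R M, IsCompl N₁ N₂ → N₁ = ⊥ ∨ N₂ = ⊥

/-- A module is equidimensional if `dim R/P = dim M` for every minimal prime `P`
of its support (equivalently, of its annihilator). -/
def Equidimensional (R : Type u) [CommRing R] (M : Type*) [AddCommGroup M]
    [Module R M] : Prop :=
  ∀ P ∈ (Module.annihilator R M).minimalPrimes, ringKrullDim (R ⧸ P) = moduleDim R M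

/-- A local ring is Cohen-Macaulay if its depth equals its Krull dimension. -/
def IsCMLocalRing (S : Type u) [CommRing S] [IsLocalRing S] : Prop :=
  ((moduleDepth S (IsLocalRing.maximalIdeal S) S : ℕ∞) : WithBot ℕ∞) = ringKrullDim S

/-- A ring is Cohen-Macaulay if all its localizations at primes are Cohen-Macaulay local
rings. -/
def IsCMRing (S : Type u) [CommRing S] : Prop :=
  ∀ p : PrimeSpectrum S, IsCMLocalRing (Localization.AtPrime p.asIdeal)

/-- A localized module is finite if and only if some finitely generated submodule contains a
multiple of every element by a member of the multiplicative set. -/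
theorem LocalizedModule.finite_iff_exists_fg {R M : Type*} [CommRing R] [AddCommGroup M]
    [Module R M] (S : Submonoid R) :
    Module.Finite (Localization S) (LocalizedModule S M) ↔
      ∃ N : Submodule R M, N.FG ∧ ∀ m : M, ∃ s ∈ S, s • m ∈ N := by
  classical
  set f := LocalizedModule.mkLinearMap S M
  constructor
  · rintro ⟨T, hT⟩
    choose r hr using IsLocalizedModule.mk'_surjective S f
    let N := Submodule.span R (T.image fun t => (r t).1 : Set M)
    refine ⟨N, ⟨_, rfl⟩, fun m => ?_⟩
    have hN : N.localized' (Localization S) S f = ⊤ := by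
      rw [eq_top_iff, ← hT, Submodule.span_le]
      intro t ht
      exact ⟨(r t).1, Submodule.subset_span (Finset.mem_image_of_mem _ ht), (r t).2, hr t⟩
    obtain ⟨n, hn, s, h⟩ := hN.ge (Submodule.mem_top (x := f m))
    rw [IsLocalizedModule.mk'_eq_iff, Submonoid.smul_def, ← map_smul] at h
    obtain ⟨c, hc⟩ := IsLocalizedModule.exists_of_eq (S := S) h
    refine ⟨c * s, (c * s).2, ?_⟩
    rw [mul_smul, ← Submonoid.smul_def c, ← hc]
    exact N.smul_mem _ hn
  · rintro ⟨N, ⟨T, rfl⟩, hN⟩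
    refine ⟨T.image f, ?_⟩
    rw [Finset.coe_image, ← Submodule.localized'_span (Localization S) S f, eq_top_iff]
    rintro z -
    obtain ⟨⟨m, s⟩, rfl⟩ := IsLocalizedModule.mk'_surjective S f z
    obtain ⟨c, hcS, hc⟩ := hN m
    exact ⟨c • m, hc, ⟨c, hcS⟩ * s, IsLocalizedModule.mk'_cancel_left f m ⟨c, hcS⟩ s⟩

/-- For localization away from `x`, finiteness means that some finitely generated submodule
`N` satisfies `x ∈ √(N : m)` for every `m`. -/
theorem LocalizedModule.finite_powers_iff_exists_fg {R M : Type*} [CommRing R] [AddCommGroup M]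
    [Module R M] (x : R) :
    Module.Finite (Localization.Away x) (LocalizedModule (Submonoid.powers x) M) ↔
      ∃ N : Submodule R M, N.FG ∧
        ∀ m : M, x ∈ Ideal.radical (N.comap (LinearMap.toSpanSingleton R M m)) := by
  rw [LocalizedModule.finite_iff_exists_fg]
  simp [Submonoid.mem_powers_iff, Ideal.mem_radical_iff]

theorem stmt1 (R : Type u) [CommRing R] [IsNoetherianRing R]
    (M : Type u) [AddCommGroup M] [Module R M] (x y : R)
    (hx : Module.Finite (Localization.Away x) (LocalizedModule (Submonoid.powers x) M))
    (hy : Module.Finite (Localization.Away y) (LocalizedModule (Submonoid.powers y) M)) :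
    Module.Finite (Localization.Away (x + y))
      (LocalizedModule (Submonoid.powers (x + y)) M) := by
  rw [LocalizedModule.finite_powers_iff_exists_fg] at hx hy ⊢
  obtain ⟨N₁, hN₁, h₁⟩ := hx
  obtain ⟨N₂, hN₂, h₂⟩ := hy
  exact ⟨N₁ ⊔ N₂, hN₁.sup hN₂, fun m => add_mem
    (Ideal.radical_mono (Submodule.comap_mono le_sup_left) (h₁ m))
    (Ideal.radical_mono (Submodule.comap_mono le_sup_right) (h₂ m))⟩
end
end

section
/- Let (R,m) be a catenary Noetherian local ring and M a finitely generated indecomposable R-module satisfying Serre's condition S_2 (as a module over R/ann(M)). Then M is equidimensional, i.e., dim R/P = dim M for all minimal primes P of the support of M. -/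
open CategoryTheory

noncomputable section

universe u

open Order Submodule IsLocalRing

/-- A longest chain starting at a point of finite coheight is saturated and ends at the top. -/
theorem exists_relSeries_covBy_of_coheight_eq {α : Type*} [PartialOrder α] [OrderTop α] {a : α}
    {n : ℕ} (h : coheight a = n) :
    ∃ c : RelSeries {(x, y) : α × α | x ⋖ y}, c.head = a ∧ c.last = ⊤ ∧ c.length = n := by
  obtain ⟨c, hc, hl⟩ := exists_series_of_coheight_eq_coe a h
  have key : ∀ d : LTSeries α, d.head = a → d.length ≤ n := fun d hd ↦ by
    have := length_le_coheight_head (p := d)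
    rw [hd, h] at this
    exact_mod_cast this
  have hcov : ∀ i : Fin c.length, c.toFun i.castSucc ⋖ c.toFun i.succ := fun i ↦ by
    refine ⟨c.step i, fun b hb hb' ↦ ?_⟩
    have hhead : (c.insertNth i b hb hb').head = a := by
      have := Fin.insertNth_apply_succAbove (α := fun _ ↦ α) i.succ.castSucc b c.toFun 0
      rw [Fin.succAbove_ne_zero_zero (by simp [Fin.ext_iff])] at this
      exact this.trans hc
    have := key (c.insertNth i b hb hb') hhead
    simp only [RelSeries.insertNth_length] at this
    omega
  refine ⟨⟨c.length, c.toFun, hcov⟩, hc, ?_, hl⟩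
  change c.last = ⊤
  by_contra hne
  have := key (c.snoc ⊤ (lt_top_iff_ne_top.mpr hne)) (by simpa using hc)
  simp only [RelSeries.snoc_length] at this
  omega

theorem IsCatenaryRing.coheight_eq_of_covBy {R : Type u} [CommRing R] [IsNoetherianRing R]
    [IsLocalRing R] (hcat : IsCatenaryRing R) {P p : PrimeSpectrum R} (h : P ⋖ p) :
    coheight P = coheight p + 1 := by
  obtain ⟨n, hn⟩ := ENat.ne_top_iff_exists.mp (coheight_lt_top P).ne
  obtain ⟨k, hk⟩ := ENat.ne_top_iff_exists.mp (coheight_lt_top p).ne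
  obtain ⟨c, hc, hc', hcl⟩ := exists_relSeries_covBy_of_coheight_eq hn.symm
  obtain ⟨d, hd, hd', hdl⟩ := exists_relSeries_covBy_of_coheight_eq hk.symm
  have hcons : P ⋖ d.head := hd ▸ h
  let d' := d.cons P hcons
  have hlen : c.length = d'.length :=
    hcat ⟨c.length, c.toFun, fun i ↦ (c.step i).lt⟩ ⟨d'.length, d'.toFun, fun i ↦ (d'.step i).lt⟩
      hc (hc'.trans (hd'.symm.trans (d.last_cons P hcons).symm)) c.step d'.step
  rw [← hn, ← hk]
  simp only [d', RelSeries.cons_length] at hlen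
  exact_mod_cast (by omega : n = k + 1)

theorem ringKrullDim_quotient_eq_coheight {R : Type u} [CommRing R] (P : PrimeSpectrum R) :
    ringKrullDim (R ⧸ P.asIdeal) = coheight P := by
  rw [ringKrullDim_quotient, coheight_eq_krullDim_Ici]
  congr 1

theorem krullDim_le_moduleDim_localizedModule {R : Type u} [CommRing R] {M : Type u}
    [AddCommGroup M] [Module R M] [Module.Finite R M] (q : PrimeSpectrum R) :
    krullDim {P : PrimeSpectrum R // Module.annihilator R M ≤ P.asIdeal ∧ P ≤ q} ≤
      moduleDim (Localization.AtPrime q.asIdeal) (LocalizedModule q.asIdeal.primeCompl M) := by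
  rw [moduleDim, ringKrullDim_quotient]
  let e := IsLocalization.AtPrime.primeSpectrumOrderIso (Localization.AtPrime q.asIdeal) q.asIdeal
  refine krullDim_le_of_strictMono (fun P ↦ ⟨e.symm ⟨P.1, P.2.2⟩, ?_⟩) ?_
  · intro x hx
    obtain ⟨r, s, rfl⟩ := IsLocalization.exists_mk'_eq q.asIdeal.primeCompl x
    have hP : P.1 ∈ Module.support R M := by
      rw [Module.support_eq_zeroLocus]
      exact P.2.1
    obtain ⟨m, hm⟩ := Module.mem_support_iff_exists_annihilator.mp hP
    have hrm : r • LocalizedModule.mkLinearMap q.asIdeal.primeCompl M m = 0 := by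
      rw [← algebraMap_smul (Localization.AtPrime q.asIdeal) r, ← IsLocalization.mk'_spec' _ r s,
        mul_smul, Module.mem_annihilator.mp hx, smul_zero]
    rw [← map_smul, ← map_zero (LocalizedModule.mkLinearMap q.asIdeal.primeCompl M),
      IsLocalizedModule.eq_iff_exists q.asIdeal.primeCompl] at hrm
    obtain ⟨t, ht⟩ := hrm
    have htr : t.1 * r ∈ P.1.asIdeal := hm (by
      rw [mem_annihilator_span_singleton, mul_smul]
      simpa [Submonoid.smul_def] using ht)
    have hr : r ∈ P.1.asIdeal :=
      (P.1.isPrime.mem_or_mem htr).resolve_left fun h ↦ t.2 (P.2.2 h)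
    rw [IsLocalization.mk'_eq_mul_mk'_one]
    exact Ideal.mul_mem_right _ _ (Ideal.mem_map_of_mem _ hr)
  · intro P Q h
    exact e.symm.strictMono (show (⟨P.1, P.2.2⟩ : Set.Iic q) < ⟨Q.1, Q.2.2⟩ from h)

theorem exists_isSMulRegular_of_one_le_moduleDepth {R : Type u} [CommRing R] {J : Ideal R}
    {M : Type*} [AddCommGroup M] [Module R M] (h : 1 ≤ moduleDepth R J M) :
    ∃ x ∈ J, IsSMulRegular M x := by
  obtain ⟨n, ⟨rs, rfl, hJ, hreg⟩, hn⟩ := lt_sSup_iff.mp (zero_lt_one.trans_le h)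
  match rs with
  | [] => simp at hn
  | x :: l => exact ⟨x, hJ x (by simp), ((RingTheory.Sequence.isRegular_cons_iff _ _ _).mp hreg).1⟩

theorem exists_isSMulRegular_pair_of_two_le_moduleDepth {R : Type u} [CommRing R] {J : Ideal R}
    {M : Type*} [AddCommGroup M] [Module R M] (h : 2 ≤ moduleDepth R J M) :
    ∃ x ∈ J, ∃ y ∈ J, IsSMulRegular M x ∧ IsSMulRegular (QuotSMulTop x M) y := by
  obtain ⟨n, ⟨rs, rfl, hJ, hreg⟩, hn⟩ := lt_sSup_iff.mp ((by norm_num : (1 : ℕ∞) < 2).trans_le h)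
  match rs with
  | [] => simp at hn
  | [x] => simp at hn
  | x :: y :: l =>
    simp only [RingTheory.Sequence.isRegular_cons_iff] at hreg
    exact ⟨x, hJ x (by simp), y, hJ y (by simp), hreg.1, hreg.2.1⟩

/-- The elementary form of the vanishing of `Hom(k, M ⧸ (N₁ ⊔ N₂))` for a module of depth at
least two. -/
theorem mem_sup_of_smul_mem_sup {A L : Type*} [CommRing A] [AddCommGroup L] [Module A L]
    {N₁ N₂ : Submodule A L} (hdis : Disjoint N₁ N₂) {x y : A} (hx : IsSMulRegular L x)
    (hy : IsSMulRegular (QuotSMulTop x L) y) (h₁ : ∀ z, x • z ∈ N₁ → z ∈ N₁)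
    (h₂ : ∀ z, x • z ∈ N₂ → z ∈ N₂) {m : L} (hxm : x • m ∈ N₁ ⊔ N₂) (hym : y • m ∈ N₁ ⊔ N₂) :
    m ∈ N₁ ⊔ N₂ := by
  obtain ⟨a, ha, b, hb, hab⟩ := mem_sup.mp hxm
  obtain ⟨a', ha', b', hb', hab'⟩ := mem_sup.mp hym
  have key : y • a - x • a' = x • b' - y • b := by
    have : y • (a + b) = x • (a' + b') := by rw [hab, hab', smul_comm]
    simp only [smul_add] at this
    rw [sub_eq_sub_iff_add_eq_add, this, add_comm]
  have hzero : y • a - x • a' = 0 := disjoint_def.mp hdis _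
    (sub_mem (N₁.smul_mem _ ha) (N₁.smul_mem _ ha'))
    (key ▸ sub_mem (N₂.smul_mem _ hb') (N₂.smul_mem _ hb))
  have div : ∀ u v : L, y • u = x • v → ∃ w, x • w = u := fun u v huv ↦ by
    have : y • (Submodule.Quotient.mk u : QuotSMulTop x L) = 0 := by
      rw [← Submodule.Quotient.mk_smul, huv, Submodule.Quotient.mk_eq_zero]
      exact smul_mem_pointwise_smul _ _ _ mem_top
    have := hy.right_eq_zero_of_smul this
    rw [Submodule.Quotient.mk_eq_zero] at this
    obtain ⟨w, -, hw⟩ := (mem_smul_pointwise_iff_exists _ _ _).mp this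
    exact ⟨w, hw⟩
  obtain ⟨a₁, rfl⟩ := div a a' (sub_eq_zero.mp hzero)
  obtain ⟨b₁, rfl⟩ := div b b' (sub_eq_zero.mp (key ▸ hzero)).symm
  rw [← hx (by simpa using hab : x • (a₁ + b₁) = x • m)]
  exact add_mem_sup (h₁ _ ha) (h₂ _ hb)

theorem mem_localized'_torsionBySet_iff {R : Type*} [CommRing R] {M : Type*} [AddCommGroup M]
    [Module R M] (S : Submonoid R) {J : Ideal R} (hJ : J.FG) (z : LocalizedModule S M) :
    z ∈ (torsionBySet R M J).localized' (Localization S) S (LocalizedModule.mkLinearMap S M) ↔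
      ∀ j ∈ J, j • z = 0 := by
  rw [mem_localized']
  constructor
  · rintro ⟨m, hm, s, rfl⟩ j hj
    rw [← IsLocalizedModule.mk'_smul, (mem_torsionBySet_iff _ _).mp hm ⟨j, hj⟩,
      IsLocalizedModule.mk'_zero]
  · intro h
    obtain ⟨⟨m, s⟩, rfl⟩ := IsLocalizedModule.mk'_surjective S (LocalizedModule.mkLinearMap S M) z
    classical
    obtain ⟨T, rfl⟩ := hJ
    have : ∀ j : T, ∃ t : S, t • (j : R) • m = 0 := fun j ↦ by
      have := h j (subset_span j.2)
      rw [Function.uncurry_apply_pair, ← IsLocalizedModule.mk'_smul,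
        IsLocalizedModule.mk'_eq_zero'] at this
      exact this
    choose t ht using this
    refine ⟨(∏ j, t j) • m, ?_, (∏ j, t j) * s, by simp⟩
    rw [mem_torsionBySet_iff]
    rintro ⟨j, hj⟩
    have hle : span R (T : Set R) ≤
        LinearMap.ker (LinearMap.toSpanSingleton R M ((∏ j, t j) • m)) := by
      refine span_le.mpr fun j hj ↦ ?_
      rw [SetLike.mem_coe, LinearMap.mem_ker, LinearMap.toSpanSingleton_apply, smul_comm,
        ← Finset.prod_erase_mul _ _ (Finset.mem_univ ⟨j, hj⟩), mul_smul, ht ⟨j, hj⟩, smul_zero]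
    exact hle hj

theorem smul_mkLinearMap_mem_localized' {R : Type*} [CommRing R] {M : Type*} [AddCommGroup M]
    [Module R M] (p : Ideal R) [p.IsPrime] {N : Submodule R M} {m : M}
    (h : ∀ r ∈ p, r • m ∈ N) {x : Localization.AtPrime p}
    (hx : x ∈ maximalIdeal (Localization.AtPrime p)) :
    x • LocalizedModule.mkLinearMap p.primeCompl M m ∈
      N.localized' (Localization.AtPrime p) p.primeCompl
        (LocalizedModule.mkLinearMap p.primeCompl M) := by
  obtain ⟨r, s, rfl⟩ := IsLocalization.exists_mk'_eq p.primeCompl x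
  rw [IsLocalization.AtPrime.mk'_mem_maximal_iff _ p] at hx
  rw [mem_localized']
  refine ⟨r • m, h r hx, s, ?_⟩
  rw [IsLocalizedModule.mk'_eq_iff, map_smul, ← smul_assoc,
    ← algebraMap_smul (Localization.AtPrime p) r, Submonoid.smul_def, Algebra.smul_def,
    IsLocalization.mk'_spec']

theorem mkLinearMap_notMem_localized' {R : Type*} [CommRing R] {M : Type*} [AddCommGroup M]
    [Module R M] (p : Ideal R) [p.IsPrime] {N : Submodule R M} {m : M}
    (h : ∀ r, r • m ∈ N → r ∈ p) :
    LocalizedModule.mkLinearMap p.primeCompl M m ∉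
      N.localized' (Localization.AtPrime p) p.primeCompl
        (LocalizedModule.mkLinearMap p.primeCompl M) := by
  rw [mem_localized']
  rintro ⟨n, hn, s, hs⟩
  rw [IsLocalizedModule.mk'_eq_iff, ← LinearMap.map_smul_of_tower,
    IsLocalizedModule.eq_iff_exists p.primeCompl] at hs
  obtain ⟨t, ht⟩ := hs
  refine (t * s).2 (h _ ?_)
  have : t • s • m ∈ N := ht ▸ N.smul_mem _ hn
  simpa only [Submonoid.smul_def, mul_smul, Submonoid.coe_mul] using this

theorem ringKrullDim_quotient_le_of_forall_minimalPrimes {R : Type u} [CommRing R] {I : Ideal R}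
    {d : WithBot ℕ∞} (h : ∀ Q ∈ I.minimalPrimes, ringKrullDim (R ⧸ Q) ≤ d) :
    ringKrullDim (R ⧸ I) ≤ d := by
  rw [ringKrullDim_quotient]
  refine iSup_le fun c ↦ ?_
  obtain ⟨Q, hQ, hle⟩ := Ideal.exists_minimalPrimes_le (J := c.head.1.asIdeal) c.head.2
  refine le_trans ?_ (h Q hQ)
  have := hQ.1.1
  rw [ringKrullDim_quotient_eq_coheight ⟨Q, this⟩]
  have := length_le_coheight (x := (⟨Q, this⟩ : PrimeSpectrum R))
    (p := c.map Subtype.val fun _ _ h ↦ h) hle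
  exact_mod_cast this

section SerreCondition

variable {R : Type u} [CommRing R] {M : Type u} [AddCommGroup M] [Module R M] [Module.Finite R M]

theorem SerreCondition.one_le_moduleDepth (hS : SerreCondition R 2 M) {P q : PrimeSpectrum R}
    (hP : Module.annihilator R M ≤ P.asIdeal) (hPq : P < q) :
    1 ≤ moduleDepth (Localization.AtPrime q.asIdeal)
      (maximalIdeal (Localization.AtPrime q.asIdeal))
      (LocalizedModule q.asIdeal.primeCompl M) := by
  have hq := hP.trans hPq.le
  have h := hS q (by rwa [Module.support_eq_zeroLocus])
  let a : {P : PrimeSpectrum R // Module.annihilator R M ≤ P.asIdeal ∧ P ≤ q} := ⟨P, hP, hPq.le⟩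
  let b : {P : PrimeSpectrum R // Module.annihilator R M ≤ P.asIdeal ∧ P ≤ q} := ⟨q, hq, le_rfl⟩
  have hab : a < b := hPq
  have hdim := (le_krullDim_iff (n := 1)).mpr
    ⟨RelSeries.cons (RelSeries.singleton _ b : LTSeries _) a hab, rfl⟩
  have := (le_min (by norm_num) (hdim.trans (krullDim_le_moduleDim_localizedModule q))).trans h
  exact_mod_cast this

theorem SerreCondition.two_le_moduleDepth (hS : SerreCondition R 2 M) {P Q q : PrimeSpectrum R}
    (hP : Module.annihilator R M ≤ P.asIdeal) (hPQ : P < Q) (hQq : Q < q) :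
    2 ≤ moduleDepth (Localization.AtPrime q.asIdeal)
      (maximalIdeal (Localization.AtPrime q.asIdeal))
      (LocalizedModule q.asIdeal.primeCompl M) := by
  have hQ := hP.trans hPQ.le
  have hq := hQ.trans hQq.le
  have h := hS q (by rwa [Module.support_eq_zeroLocus])
  let a : {P : PrimeSpectrum R // Module.annihilator R M ≤ P.asIdeal ∧ P ≤ q} :=
    ⟨P, hP, (hPQ.trans hQq).le⟩
  let b : {P : PrimeSpectrum R // Module.annihilator R M ≤ P.asIdeal ∧ P ≤ q} := ⟨Q, hQ, hQq.le⟩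
  let c : {P : PrimeSpectrum R // Module.annihilator R M ≤ P.asIdeal ∧ P ≤ q} := ⟨q, hq, le_rfl⟩
  have hab : a < b := hPQ
  have hbc : b < c := hQq
  have hdim := (le_krullDim_iff (n := 2)).mpr
    ⟨RelSeries.cons (RelSeries.cons (RelSeries.singleton _ c : LTSeries _) b hbc) a hab, rfl⟩
  have := (le_min le_rfl (hdim.trans (krullDim_le_moduleDim_localizedModule q))).trans h
  exact WithBot.coe_le_coe.mp this

end SerreCondition

theorem exists_isPrime_forall_smul_mem_iff {R : Type*} [CommRing R] [IsNoetherianRing R]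
    {M : Type*} [AddCommGroup M] [Module R M] {N N' : Submodule R M} (h : ¬ N' ≤ N) :
    ∃ m ∈ N', ∃ p : PrimeSpectrum R, ∀ r : R, r • m ∈ N ↔ r ∈ p.asIdeal := by
  obtain ⟨x, hx, hxN⟩ := SetLike.not_le_iff_exists.mp h
  obtain ⟨p, hp, -⟩ := exists_le_isAssociatedPrime_of_isNoetherianRing R
    (⟨N.mkQ x, mem_map_of_mem hx⟩ : N'.map N.mkQ) (by simpa [Subtype.ext_iff] using hxN)
  obtain ⟨hprime, ⟨_, m, hm, rfl⟩, rfl⟩ := isAssociatedPrime_iff.mp hp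
  refine ⟨m, hm, ⟨_, hprime⟩, fun r ↦ ?_⟩
  simp [mem_colon_singleton, Subtype.ext_iff, ← Submodule.Quotient.mk_smul]

theorem exists_ideals_of_minimalPrimes_eq_union {R : Type*} [CommRing R] [IsNoetherianRing R]
    {I : Ideal R} {A B : Finset (Ideal R)} (hAB : I.minimalPrimes = A ∪ B) :
    ∃ J K : Ideal R, J * K ≤ I ∧
      (∀ q : Ideal R, q.IsPrime → J ≤ q → ∃ P ∈ A, P ≤ q) ∧
      (∀ q : Ideal R, q.IsPrime → K ≤ q → ∃ P ∈ B, P ≤ q) := by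
  obtain ⟨n, hn⟩ := I.exists_radical_pow_le_of_fg I.radical.fg_of_isNoetherianRing
  have key : ∀ (A : Finset (Ideal R)) (q : Ideal R), q.IsPrime → (A.inf id) ^ n ≤ q →
      ∃ P ∈ A, P ≤ q := fun A q hq h ↦ hq.inf_le'.mp (hq.le_of_pow_le h)
  refine ⟨(A.inf id) ^ n, (B.inf id) ^ n, ?_, key A, key B⟩
  rw [← mul_pow]
  refine le_trans (Ideal.pow_right_mono ?_ n) hn
  rw [← Ideal.sInf_minimalPrimes, hAB, Finset.coe_union, sInf_union, ← Finset.inf_id_eq_sInf,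
    ← Finset.inf_id_eq_sInf]
  exact Ideal.mul_le_inf

theorem localized'_sup {R : Type*} (A : Type*) {M L : Type*} [CommRing R] [CommRing A] [Algebra R A]
    [AddCommGroup M] [Module R M] [AddCommGroup L] [Module R L] [Module A L] [IsScalarTower R A L]
    (S : Submonoid R) [IsLocalization S A] (f : M →ₗ[R] L) [IsLocalizedModule S f]
    (N N' : Submodule R M) :
    (N ⊔ N').localized' A S f = N.localized' A S f ⊔ N'.localized' A S f :=
  SupHomClass.map_sup (β := Submodule A L) (localized'FrameHom A S f) N N'

/-- The submodules annihilated by two ideals whose product annihilates an `S₂` module are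
complementary as soon as the corresponding closed subsets of the support never meet in
codimension at most one. -/
theorem SerreCondition.isCompl_torsionBySet {R : Type u} [CommRing R] [IsNoetherianRing R]
    {M : Type u} [AddCommGroup M] [Module R M] [Module.Finite R M] (hS : SerreCondition R 2 M)
    {J K : Ideal R} (hJK : J * K ≤ Module.annihilator R M)
    (h : ∀ q : PrimeSpectrum R, J ≤ q.asIdeal → K ≤ q.asIdeal →
      ∃ P Q : PrimeSpectrum R, Module.annihilator R M ≤ P.asIdeal ∧ P < Q ∧ Q < q) :
    IsCompl (torsionBySet R M J) (torsionBySet R M K) := by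
  have hdis : Disjoint (torsionBySet R M J) (torsionBySet R M K) := by
    rw [disjoint_iff_inf_le]
    by_contra hne
    obtain ⟨m, hm, q, hq⟩ := exists_isPrime_forall_smul_mem_iff hne
    obtain ⟨P, Q, hP, hPQ, hQq⟩ := h q
      (fun r hr ↦ (hq r).mp ((mem_torsionBySet_iff _ _).mp hm.1 ⟨r, hr⟩))
      (fun r hr ↦ (hq r).mp ((mem_torsionBySet_iff _ _).mp hm.2 ⟨r, hr⟩))
    obtain ⟨x, hx, hreg⟩ :=
      exists_isSMulRegular_of_one_le_moduleDepth (hS.one_le_moduleDepth hP (hPQ.trans hQq))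
    have hxm := smul_mkLinearMap_mem_localized' q.asIdeal (fun r hr ↦ (hq r).mpr hr) hx
    refine mkLinearMap_notMem_localized' q.asIdeal (fun r hr ↦ (hq r).mp hr) ?_
    rw [localized'_bot, mem_bot] at hxm ⊢
    exact hreg.right_eq_zero_of_smul hxm
  refine ⟨hdis, codisjoint_iff_le_sup.mpr ?_⟩
  by_contra hne
  obtain ⟨m, -, q, hq⟩ := exists_isPrime_forall_smul_mem_iff hne
  have hkill : ∀ j ∈ J, ∀ k ∈ K, j • k • m = 0 := fun j hj k hk ↦ by
    rw [← mul_smul]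
    exact Module.mem_annihilator.mp (hJK (Ideal.mul_mem_mul hj hk)) m
  obtain ⟨P, Q, hP, hPQ, hQq⟩ := h q
    (fun j hj ↦ (hq j).mp (mem_sup_right ((mem_torsionBySet_iff _ _).mpr fun k ↦ by
      rw [smul_comm]; exact hkill j hj k k.2)))
    (fun k hk ↦ (hq k).mp (mem_sup_left ((mem_torsionBySet_iff _ _).mpr fun j ↦
      hkill j j.2 k hk)))
  obtain ⟨x, hx, y, hy, hxreg, hyreg⟩ :=
    exists_isSMulRegular_pair_of_two_le_moduleDepth (hS.two_le_moduleDepth hP hPQ hQq)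
  have hmem {z} := smul_mkLinearMap_mem_localized' q.asIdeal (fun r hr ↦ (hq r).mpr hr) (x := z)
  refine mkLinearMap_notMem_localized' q.asIdeal (fun r hr ↦ (hq r).mp hr) ?_
  have hsat : ∀ J : Ideal R, ∀ z,
      x • z ∈ (torsionBySet R M J).localized' (Localization.AtPrime q.asIdeal)
        q.asIdeal.primeCompl (LocalizedModule.mkLinearMap q.asIdeal.primeCompl M) →
      z ∈ (torsionBySet R M J).localized' (Localization.AtPrime q.asIdeal)
        q.asIdeal.primeCompl (LocalizedModule.mkLinearMap q.asIdeal.primeCompl M) := fun J z hz ↦ by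
    rw [mem_localized'_torsionBySet_iff _ J.fg_of_isNoetherianRing] at hz ⊢
    exact fun j hj ↦ hxreg.right_eq_zero_of_smul ((smul_comm ..).trans (hz j hj))
  rw [localized'_sup] at hmem ⊢
  refine mem_sup_of_smul_mem_sup ?_ hxreg hyreg (hsat J) (hsat K) (hmem hx) (hmem hy)
  rw [disjoint_iff, ← localized'_inf, hdis.eq_bot, localized'_bot]

theorem stmt3 (R : Type u) [CommRing R] [IsNoetherianRing R] [IsLocalRing R]
    (hcat : IsCatenaryRing R)
    (M : Type u) [AddCommGroup M] [Module R M] [Module.Finite R M]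
    (hind : ModuleIndecomposable R M) (hS2 : SerreCondition R 2 M) :
    Equidimensional R M := by
  intro P₀ hP₀
  by_contra hne
  classical
  let F := (Ideal.finite_minimalPrimes_of_isNoetherianRing R (Module.annihilator R M)).toFinset
  let A := F.filter fun P ↦ ringKrullDim (R ⧸ P) = ringKrullDim (R ⧸ P₀)
  let B := F.filter fun P ↦ ringKrullDim (R ⧸ P) ≠ ringKrullDim (R ⧸ P₀)
  have hA : ∀ {P}, P ∈ A → P ∈ (Module.annihilator R M).minimalPrimes ∧
      ringKrullDim (R ⧸ P) = ringKrullDim (R ⧸ P₀) := by simp [A, F]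
  have hB : ∀ {P}, P ∈ B → P ∈ (Module.annihilator R M).minimalPrimes ∧
      ringKrullDim (R ⧸ P) ≠ ringKrullDim (R ⧸ P₀) := by simp [B, F]
  have hAB : ∀ {P Q}, P ∈ A → Q ∈ B → ¬ P ≤ Q ∧ ¬ Q ≤ P := fun {P Q} hP hQ ↦ by
    have hPQ : P ≠ Q := fun h ↦ (hB hQ).2 (h ▸ (hA hP).2)
    exact ⟨fun h ↦ hPQ (h.antisymm ((hB hQ).1.2 (hA hP).1.1 h)),
      fun h ↦ hPQ (((hA hP).1.2 (hB hQ).1.1 h).antisymm h)⟩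
  have hP₀A : P₀ ∈ A := by simp [A, F, hP₀]
  obtain ⟨Q₀, hQ₀⟩ : B.Nonempty := by
    by_contra hempty
    refine hne (le_antisymm ?_ ?_)
    · exact ringKrullDim_le_of_surjective (Ideal.Quotient.factor hP₀.1.2)
        (Ideal.Quotient.factor_surjective hP₀.1.2)
    · refine ringKrullDim_quotient_le_of_forall_minimalPrimes fun Q hQ ↦ ?_
      by_contra hlt
      exact hempty ⟨Q, by simpa [B, F, hQ] using fun h ↦ hlt h.le⟩
  obtain ⟨J, K, hJK, hJ, hK⟩ := exists_ideals_of_minimalPrimes_eq_union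
    (I := Module.annihilator R M) (A := A) (B := B)
    (by ext P; simp [A, B, F, ← and_or_left, em])
  have hcompl : IsCompl (torsionBySet R M J) (torsionBySet R M K) := by
    refine hS2.isCompl_torsionBySet hJK fun q hJq hKq ↦ ?_
    obtain ⟨P, hP, hPq⟩ := hJ _ q.isPrime hJq
    obtain ⟨Q, hQ, hQq⟩ := hK _ q.isPrime hKq
    let P' : PrimeSpectrum R := ⟨P, (hA hP).1.1.1⟩
    let Q' : PrimeSpectrum R := ⟨Q, (hB hQ).1.1.1⟩
    have hPq' : P' < q := lt_of_le_of_ne hPq fun h ↦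
      (hAB hP hQ).2 (show Q ≤ P'.asIdeal from h ▸ hQq)
    have hQq' : Q' < q := lt_of_le_of_ne hQq fun h ↦
      (hAB hP hQ).1 (show P ≤ Q'.asIdeal from h ▸ hPq)
    by_cases hPcov : P' ⋖ q
    · by_cases hQcov : Q' ⋖ q
      · refine absurd ?_ (hB hQ).2
        rw [← (hA hP).2, ringKrullDim_quotient_eq_coheight P', ringKrullDim_quotient_eq_coheight Q',
          hcat.coheight_eq_of_covBy hPcov, hcat.coheight_eq_of_covBy hQcov]
      · obtain ⟨S, h₁, h₂⟩ := exists_lt_lt_of_not_covBy hQq' hQcov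
        exact ⟨Q', S, (hB hQ).1.1.2, h₁, h₂⟩
    · obtain ⟨S, h₁, h₂⟩ := exists_lt_lt_of_not_covBy hPq' hPcov
      exact ⟨P', S, (hA hP).1.1.2, h₁, h₂⟩
  have hle : ∀ {J K : Ideal R}, J * K ≤ Module.annihilator R M → torsionBySet R M J = ⊥ →
      K ≤ Module.annihilator R M := fun {J K} hJK hbot k hk ↦ by
    refine Module.mem_annihilator.mpr fun m ↦ ?_
    rw [← mem_bot R, ← hbot, mem_torsionBySet_iff]
    intro j
    rw [← mul_smul]
    exact Module.mem_annihilator.mp (hJK (Ideal.mul_mem_mul j.2 hk)) m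
  rcases hind.2 _ _ hcompl with h | h
  · obtain ⟨Q, hQ, hQP⟩ := hK P₀ hP₀.1.1 ((hle hJK h).trans hP₀.1.2)
    exact (hAB hP₀A hQ).2 hQP
  · obtain ⟨P, hP, hPQ⟩ := hJ Q₀ (hB hQ₀).1.1.1
      ((hle (mul_comm J K ▸ hJK) h).trans (hB hQ₀).1.1.2)
    exact (hAB hP hQ₀).1 hPQ
end
end

section
/- Let R be a Noetherian ring, I an ideal, and M a finitely generated R-module. Suppose there exists an integer h ≥ 0 such that the local cohomology module H^i_I(M) is I-cofinite for all i ≠ h. Then H^h_I(M) is also I-cofinite, hence H^i_I(M) is I-cofinite for all i. -/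
open CategoryTheory

noncomputable section

universe u

section ExtComparison

open Limits Abelian

variable {R : Type u} [CommRing R]

namespace CategoryTheory.ProjectiveResolution

variable {X N : ModuleCat.{u} R} (P : ProjectiveResolution X)

/-- The complex in the opposite category whose homology computes the derived functor `Ext`. -/
def yonedaComplex (N : ModuleCat.{u} R) : ChainComplex (ModuleCat.{u} R)ᵒᵖ ℕ :=
  (((linearYoneda R (ModuleCat.{u} R)).obj N).rightOp.mapHomologicalComplex _).obj P.complex

/-- The module of degree `n` cocycles of the complex `Hom(P, N)`. -/
def extCocycles (N : ModuleCat.{u} R) (n : ℕ) : ModuleCat.{u} R :=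
  ((P.yonedaComplex N).opcycles n).unop

/-- The inclusion of the cocycles in the cochains. -/
def extCocyclesι (N : ModuleCat.{u} R) (n : ℕ) :
    P.extCocycles N n ⟶ ModuleCat.of R (P.complex.X n ⟶ N) :=
  ((P.yonedaComplex N).pOpcycles n).unop

/-- The cohomology class of a cocycle. -/
def extCocyclesπ (N : ModuleCat.{u} R) (n : ℕ) :
    P.extCocycles N n ⟶
      ((_root_.Ext R (ModuleCat.{u} R) n).obj (Opposite.op X)).obj N :=
  ((P.isoLeftDerivedObj ((linearYoneda R (ModuleCat.{u} R)).obj N).rightOp n).hom ≫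
    (P.yonedaComplex N).homologyι n).unop

lemma extCocyclesπ_surjective (n : ℕ) : Function.Surjective (P.extCocyclesπ N n) := by
  rw [← ModuleCat.epi_iff_surjective]
  unfold extCocyclesπ
  have : Mono ((P.yonedaComplex N).homologyι n) :=
    mono_of_isLimit_fork ((P.yonedaComplex N).homologyIsKernel n _ rfl)
  exact @unop_epi_of_mono _ _ _ _ _ (@mono_comp _ _ _ _ _ _ inferInstance _ this)

lemma extCocyclesι_injective (n : ℕ) : Function.Injective (P.extCocyclesι N n) := by
  rw [← ModuleCat.mono_iff_injective]
  unfold extCocyclesι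
  exact unop_mono_of_epi _

lemma d_comp_extCocyclesι (n : ℕ) (z : P.extCocycles N n) :
    P.complex.d (n + 1) n ≫ (P.extCocyclesι N n z : P.complex.X n ⟶ N) = 0 := by
  have h := congrArg Quiver.Hom.unop ((P.yonedaComplex N).d_pOpcycles (n + 1) n)
  exact ConcreteCategory.congr_hom h z

lemma exists_extCocyclesι_eq (n : ℕ) (f : P.complex.X n ⟶ N)
    (hf : P.complex.d (n + 1) n ≫ f = 0) : ∃ z, P.extCocyclesι N n z = f := by
  have h := (ShortComplex.exact_of_g_is_cokernel
    (ShortComplex.mk _ _ ((P.yonedaComplex N).d_pOpcycles (n + 1) n))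
    ((P.yonedaComplex N).opcyclesIsCokernel (n + 1) n (by simp))).unop
  rw [ShortComplex.moduleCat_exact_iff] at h
  exact h f hf

lemma extCocyclesπ_eq_zero_iff (n : ℕ) (z : P.extCocycles N n) :
    P.extCocyclesπ N n z = 0 ↔ ∃ g : P.complex.X ((ComplexShape.down ℕ).next n) ⟶ N,
      P.complex.d n _ ≫ g = P.extCocyclesι N n z := by
  have h := (ShortComplex.exact_of_f_is_kernel
    (ShortComplex.mk _ _ ((P.yonedaComplex N).homologyι_comp_fromOpcycles n
      ((ComplexShape.down ℕ).next n)))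
    ((P.yonedaComplex N).homologyIsKernel n _ rfl)).unop
  rw [ShortComplex.moduleCat_exact_iff] at h
  have hd := ConcreteCategory.congr_hom (congrArg Quiver.Hom.unop
    ((P.yonedaComplex N).p_fromOpcycles n ((ComplexShape.down ℕ).next n)))
  have hw := ConcreteCategory.congr_hom (congrArg Quiver.Hom.unop
    ((P.yonedaComplex N).homologyι_comp_fromOpcycles n ((ComplexShape.down ℕ).next n)))
  have hi := (ModuleCat.mono_iff_injective
    (P.isoLeftDerivedObj ((linearYoneda R (ModuleCat.{u} R)).obj N).rightOp n).hom.unop).1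
      inferInstance
  have hπ : P.extCocyclesπ N n z = 0 ↔ ((P.yonedaComplex N).homologyι n).unop z = 0 :=
    ⟨fun h ↦ hi (h.trans (map_zero _).symm), fun h ↦ (congrArg
      (P.isoLeftDerivedObj ((linearYoneda R (ModuleCat.{u} R)).obj N).rightOp n).hom.unop h).trans
      (map_zero _)⟩
  rw [hπ]
  constructor
  · intro hz
    obtain ⟨g, hg⟩ := h z hz
    refine ⟨g, (hd g).symm.trans ?_⟩
    exact congrArg ((P.yonedaComplex N).pOpcycles n).unop hg
  · rintro ⟨g, hg⟩
    have : z = ((P.yonedaComplex N).fromOpcycles n _).unop g :=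
      P.extCocyclesι_injective n (hg.symm.trans (hd g).symm)
    rw [this]
    exact hw g

lemma extMk_eq_zero_iff_next {n : ℕ} (f : P.complex.X n ⟶ N)
    (hf : P.complex.d (n + 1) n ≫ f = 0) :
    P.extMk f (n + 1) rfl hf = 0 ↔
      ∃ g : P.complex.X ((ComplexShape.down ℕ).next n) ⟶ N, P.complex.d n _ ≫ g = f := by
  cases n with
  | succ p =>
    rw [P.extMk_eq_zero_iff f _ rfl hf p rfl]
    have : (ComplexShape.down ℕ).next (p + 1) = p := by simp
    rw [this]
  | zero =>
    have hd : P.complex.d 0 ((ComplexShape.down ℕ).next 0) = 0 := P.complex.shape _ _ (by simp)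
    simp only [hd, zero_comp, exists_const]
    rw [← P.extEquivCohomologyClass.apply_eq_iff_eq, extEquivCohomologyClass_extMk,
      extEquivCohomologyClass_zero, CochainComplex.HomComplex.CohomologyClass.mk_eq_zero_iff,
      CochainComplex.HomComplex.Cocycle.toSingleMk_mem_coboundaries_iff _ _ _ _ _ 1 (by lia)]
    have h1 : P.cochainComplex.d (-(0 : ℕ) : ℤ) 1 = 0 := by
      refine IsZero.eq_of_tgt ?_ _ _
      exact P.cochainComplex.isZero_of_isStrictlyLE 0 1 (by lia)
    constructor
    · rintro ⟨g, hg⟩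
      rw [← cancel_epi (P.cochainComplexXIso (-(0 : ℕ) : ℤ) 0 rfl).hom]
      rw [← hg, h1, zero_comp, comp_zero]
    · intro h
      exact ⟨0, by simp [← h]⟩

/-- The class in `Abelian.Ext` of a cocycle, as a linear map. -/
def extCocyclesMk (N : ModuleCat.{u} R) (n : ℕ) :
    P.extCocycles N n →ₗ[R] Abelian.Ext X N n where
  toFun z := P.extMk (P.extCocyclesι N n z) (n + 1) rfl (P.d_comp_extCocyclesι n z)
  map_add' x y := by
    rw [add_extMk]
    congr 1
    exact map_add _ _ _
  map_smul' r x := by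
    have := P.extMk_comp_mk₀ (P.extCocyclesι N n x) (n + 1) rfl (P.d_comp_extCocyclesι n x)
      (r • 𝟙 N)
    rw [← Abelian.Ext.smul_eq_comp_mk₀] at this
    rw [RingHom.id_apply, this]
    congr 1
    rw [Linear.comp_smul, Category.comp_id]
    exact map_smul (P.extCocyclesι N n).hom _ _

lemma extCocyclesMk_surjective (n : ℕ) : Function.Surjective (P.extCocyclesMk N n) := by
  intro x
  obtain ⟨f, hf, rfl⟩ := P.extMk_surjective x (n + 1) rfl
  obtain ⟨z, rfl⟩ := P.exists_extCocyclesι_eq n f hf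
  exact ⟨z, rfl⟩

lemma ker_extCocyclesMk (n : ℕ) :
    LinearMap.ker (P.extCocyclesMk N n) = LinearMap.ker (P.extCocyclesπ N n).hom := by
  ext z
  exact (P.extMk_eq_zero_iff_next _ (P.d_comp_extCocyclesι n z)).trans
    (P.extCocyclesπ_eq_zero_iff n z).symm

/-- The comparison isomorphism between the two definitions of `Ext`. -/
def extComparison (N : ModuleCat.{u} R) (n : ℕ) :
    ((_root_.Ext R (ModuleCat.{u} R) n).obj (Opposite.op X)).obj N ≃ₗ[R] Abelian.Ext X N n :=
  ((P.extCocyclesπ N n).hom.quotKerEquivOfSurjective (P.extCocyclesπ_surjective n)).symm ≪≫ₗ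
    Submodule.quotEquivOfEq _ _ (P.ker_extCocyclesMk n).symm ≪≫ₗ
    (P.extCocyclesMk N n).quotKerEquivOfSurjective (P.extCocyclesMk_surjective n)

lemma extComparison_extCocyclesπ (n : ℕ) (z : P.extCocycles N n) :
    P.extComparison N n (P.extCocyclesπ N n z) = P.extCocyclesMk N n z := by
  have h : ((P.extCocyclesπ N n).hom.quotKerEquivOfSurjective
      (P.extCocyclesπ_surjective n)).symm (P.extCocyclesπ N n z) = Submodule.Quotient.mk z := by
    rw [LinearEquiv.symm_apply_eq]
    rfl
  simp only [extComparison, LinearEquiv.trans_apply, h]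
  rfl

lemma extComparison_naturality {X' : ModuleCat.{u} R} (P' : ProjectiveResolution X')
    (g : X' ⟶ X) (n : ℕ)
    (x : ((_root_.Ext R (ModuleCat.{u} R) n).obj (Opposite.op X)).obj N) :
    P'.extComparison N n ((((_root_.Ext R (ModuleCat.{u} R) n).map g.op).app N) x) =
      (Abelian.Ext.mk₀ g).comp (P.extComparison N n x) (zero_add n) := by
  obtain ⟨z, rfl⟩ := P.extCocyclesπ_surjective n x
  let φ : Hom P' P g := ⟨lift g P' P, HomologicalComplex.congr_hom (lift_commutes g P' P) 0⟩
  let F := ((linearYoneda R (ModuleCat.{u} R)).obj N).rightOp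
  let ψ : P'.yonedaComplex N ⟶ P.yonedaComplex N := (F.mapHomologicalComplex _).map φ.hom
  have hψ : (F.leftDerived n).map g ≫ (P.isoLeftDerivedObj F n).hom ≫
      (P.yonedaComplex N).homologyι n =
        ((P'.isoLeftDerivedObj F n).hom ≫ (P'.yonedaComplex N).homologyι n) ≫
          HomologicalComplex.opcyclesMap ψ n := by
    have h := isoLeftDerivedObj_hom_naturality g P' P φ.hom
      (by simpa using φ.hom_f_zero_comp_π_f_zero) F n
    exact (Category.assoc _ _ _).symm.trans ((congrArg
      (fun k ↦ k ≫ (P.yonedaComplex N).homologyι n) h).trans ((Category.assoc _ _ _).trans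
        ((congrArg ((P'.isoLeftDerivedObj F n).hom ≫ ·)
          (HomologicalComplex.homologyι_naturality ψ n)).trans (Category.assoc _ _ _).symm)))
  let w : P'.extCocycles N n := (HomologicalComplex.opcyclesMap ψ n).unop z
  have h₁ : (((_root_.Ext R (ModuleCat.{u} R) n).map g.op).app N) (P.extCocyclesπ N n z) =
      P'.extCocyclesπ N n w :=
    ConcreteCategory.congr_hom (congrArg Quiver.Hom.unop hψ) z
  have h₂ : P'.extCocyclesι N n w =
      φ.hom.f n ≫ P.extCocyclesι N n z :=
    ConcreteCategory.congr_hom (congrArg Quiver.Hom.unop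
      (HomologicalComplex.p_opcyclesMap ψ n)) z
  rw [h₁, extComparison_extCocyclesπ, extComparison_extCocyclesπ]
  refine Eq.trans ?_ (mk₀_comp_extMk _ _ rfl (P.d_comp_extCocyclesι n z) φ).symm
  unfold extCocyclesMk
  dsimp
  congr 1

end CategoryTheory.ProjectiveResolution

end ExtComparison

section PowTorsion

variable {R : Type*} [CommRing R]

/-- If `C` is injective and `ker f ≤ ker g`, then `g` factors through `f`. -/
lemma Module.Injective.exists_comp_eq_of_ker_le {R : Type u} [CommRing R] {A B C : Type u}
    [AddCommGroup A] [Module R A] [AddCommGroup B] [Module R B] [AddCommGroup C] [Module R C]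
    [Module.Injective R C] (f : A →ₗ[R] B) (g : A →ₗ[R] C)
    (hfg : LinearMap.ker f ≤ LinearMap.ker g) : ∃ k : B →ₗ[R] C, ∀ x, k (f x) = g x := by
  obtain ⟨k, hk⟩ := Module.Injective.out ((LinearMap.ker f).liftQ f le_rfl)
    (LinearMap.ker_eq_bot.1 (Submodule.ker_liftQ_eq_bot _ _ _ le_rfl))
    ((LinearMap.ker f).liftQ g hfg)
  exact ⟨k, fun x => by simpa using hk (Submodule.Quotient.mk x)⟩

/-- The submodule of elements annihilated by some power of `I`. -/
def powTorsion (I : Ideal R) (N : Type*) [AddCommGroup N] [Module R N] : Submodule R N where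
  carrier := {x | ∃ n : ℕ, ∀ a ∈ I ^ n, a • x = 0}
  zero_mem' := ⟨0, fun a _ => smul_zero a⟩
  add_mem' := by
    rintro x y ⟨m, hm⟩ ⟨n, hn⟩
    refine ⟨m + n, fun a ha => ?_⟩
    rw [smul_add, hm a (Ideal.pow_le_pow_right (Nat.le_add_right m n) ha),
      hn a (Ideal.pow_le_pow_right (Nat.le_add_left n m) ha), add_zero]
  smul_mem' := by
    rintro c x ⟨n, hn⟩
    exact ⟨n, fun a ha => by rw [smul_comm, hn a ha, smul_zero]⟩

variable (I : Ideal R) {N N' : Type*} [AddCommGroup N] [Module R N] [AddCommGroup N']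
  [Module R N']

lemma map_mem_powTorsion (f : N →ₗ[R] N') {x : N} (hx : x ∈ powTorsion I N) :
    f x ∈ powTorsion I N' := by
  obtain ⟨n, hn⟩ := hx
  exact ⟨n, fun a ha => by rw [← map_smul, hn a ha, map_zero]⟩

/-- The functoriality of the `I`-power torsion. -/
def powTorsionMap (f : N →ₗ[R] N') : powTorsion I N →ₗ[R] powTorsion I N' :=
  f.restrict fun _ => map_mem_powTorsion I f

@[simp]
lemma coe_powTorsionMap (f : N →ₗ[R] N') (x : powTorsion I N) :
    (powTorsionMap I f x : N') = f x := rfl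

/-- For a finitely generated submodule of the `I`-power torsion a single power of `I` suffices. -/
lemma exists_pow_smul_eq_zero_of_fg {P : Submodule R N} (hP : P.FG) (hle : P ≤ powTorsion I N) :
    ∃ n : ℕ, ∀ a ∈ I ^ n, ∀ x ∈ P, a • x = 0 := by
  induction P, hP using Submodule.fg_induction with
  | singleton x =>
    obtain ⟨n, hn⟩ := hle (Submodule.mem_span_singleton_self x)
    refine ⟨n, fun a ha y hy => ?_⟩
    obtain ⟨c, rfl⟩ := Submodule.mem_span_singleton.1 hy
    rw [smul_comm, hn a ha, smul_zero]
  | sup P Q hP hQ =>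
    rename_i h₁ h₂
    obtain ⟨m, hm⟩ := h₁ (le_sup_left.trans hle)
    obtain ⟨n, hn⟩ := h₂ (le_sup_right.trans hle)
    refine ⟨m + n, fun a ha x hx => ?_⟩
    obtain ⟨y, hy, z, hz, rfl⟩ := Submodule.mem_sup.1 hx
    rw [smul_add, hm a (Ideal.pow_le_pow_right (Nat.le_add_right m n) ha) y hy,
      hn a (Ideal.pow_le_pow_right (Nat.le_add_left n m) ha) z hz, add_zero]

lemma mem_powTorsion_of_smul_mem (hI : I.FG) {x : N} (hx : ∀ a ∈ I, a • x ∈ powTorsion I N) :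
    x ∈ powTorsion I N := by
  obtain ⟨n, hn⟩ := exists_pow_smul_eq_zero_of_fg I
    (P := Submodule.map (LinearMap.toSpanSingleton R N x) I) (Submodule.FG.map _ hI) (by
      rintro _ ⟨a, ha, rfl⟩
      exact hx a ha)
  refine ⟨n + 1, fun a ha => ?_⟩
  rw [pow_succ] at ha
  induction ha using Submodule.mul_induction_on' with
  | mem_mul_mem b hb c hc =>
    rw [mul_smul]
    exact hn b hb _ ⟨c, hc, rfl⟩
  | add y _ z _ hy hz => rw [add_smul, hy, hz, add_zero]

lemma support_subset_zeroLocus_of_forall_mem_powTorsion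
    (h : ∀ x : N, x ∈ powTorsion I N) :
    Module.support R N ⊆ PrimeSpectrum.zeroLocus (I : Set R) := by
  intro p hp
  obtain ⟨x, hx⟩ := Module.mem_support_iff'.1 hp
  obtain ⟨n, hn⟩ := h x
  rw [PrimeSpectrum.mem_zeroLocus, SetLike.coe_subset_coe]
  refine Ideal.IsPrime.le_of_pow_le (n := n) fun a ha => ?_
  by_contra hap
  exact hx a hap (hn a ha)

/-- Over a Noetherian ring, the `I`-power torsion of an injective module is injective. -/
theorem injective_powTorsion {R : Type u} [CommRing R] [IsNoetherianRing R] (I : Ideal R)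
    (E : Type u) [AddCommGroup E] [Module R E] [Module.Injective R E] :
    Module.Injective R (powTorsion I E) := by
  refine Module.Baer.injective fun J g => ?_
  obtain ⟨n, hn⟩ := exists_pow_smul_eq_zero_of_fg I
    (P := LinearMap.range ((powTorsion I E).subtype ∘ₗ g))
    (by rw [LinearMap.range_eq_map]; exact Module.Finite.fg_top.map _) (by
      rintro _ ⟨x, rfl⟩
      exact (g x).2)
  obtain ⟨k, hk⟩ := Ideal.exists_pow_inf_eq_pow_smul I (J : Submodule R R)
  have hle : LinearMap.ker ((I ^ (n + k)).mkQ ∘ₗ J.subtype) ≤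
      LinearMap.ker ((powTorsion I E).subtype ∘ₗ g) := by
    intro x hx
    have hx' : (x : R) ∈ I ^ (n + k) := Ideal.Quotient.eq_zero_iff_mem.1 hx
    have hmem : (x : R) ∈ I ^ n • (I ^ k • ⊤ ⊓ J : Submodule R R) := by
      have := hk (n + k) (Nat.le_add_left k n)
      rw [Nat.add_sub_cancel] at this
      rw [← this]
      exact ⟨by simpa using hx', x.2⟩
    have hker : I ^ n • (I ^ k • ⊤ ⊓ J : Submodule R R) ≤
        (LinearMap.ker ((powTorsion I E).subtype ∘ₗ g)).map J.subtype := by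
      refine Submodule.smul_le.2 fun a ha y hy => ⟨a • ⟨y, hy.2⟩, ?_, rfl⟩
      change ((powTorsion I E).subtype ∘ₗ g) (a • _) = 0
      rw [map_smul]
      exact hn a ha _ ⟨_, rfl⟩
    obtain ⟨y, hy, hyx⟩ := hker hmem
    rwa [Subtype.ext hyx] at hy
  obtain ⟨φ, hφ⟩ := Module.Injective.exists_comp_eq_of_ker_le _ _ hle
  refine ⟨(φ ∘ₗ (I ^ (n + k)).mkQ).codRestrict _ fun r => ⟨n + k, fun a ha => ?_⟩, fun x hx => ?_⟩
  · rw [← map_smul, LinearMap.comp_apply]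
    have : (I ^ (n + k)).mkQ (a • r) = 0 := by
      rw [Submodule.mkQ_apply, Submodule.Quotient.mk_eq_zero]
      exact Ideal.mul_mem_right _ _ ha
    rw [this, map_zero]
  · ext
    exact hφ ⟨x, hx⟩

end PowTorsion

section ExtPowColimit

open Abelian

/-- The descent of a linear map along a surjection. -/
def LinearMap.descend {R A B C : Type*} [CommRing R] [AddCommGroup A] [Module R A]
    [AddCommGroup B] [Module R B] [AddCommGroup C] [Module R C] (p : A →ₗ[R] B)
    (hp : Function.Surjective p) (g : A →ₗ[R] C) (h : LinearMap.ker p ≤ LinearMap.ker g) :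
    B →ₗ[R] C :=
  (LinearMap.ker p).liftQ g h ∘ₗ (p.quotKerEquivOfSurjective hp).symm.toLinearMap

lemma LinearMap.descend_apply {R A B C : Type*} [CommRing R] [AddCommGroup A] [Module R A]
    [AddCommGroup B] [Module R B] [AddCommGroup C] [Module R C] (p : A →ₗ[R] B)
    (hp : Function.Surjective p) (g : A →ₗ[R] C) (h : LinearMap.ker p ≤ LinearMap.ker g) (a : A) :
    p.descend hp g h (p a) = g a := by
  have : (p.quotKerEquivOfSurjective hp).symm (p a) = Submodule.Quotient.mk a := by
    rw [LinearEquiv.symm_apply_eq]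
    rfl
  rw [LinearMap.descend, LinearMap.comp_apply, LinearEquiv.coe_coe, this, Submodule.liftQ_apply]

variable {R : Type u} [CommRing R] (I : Ideal R)

/-- The quotient `R ⧸ I ^ t`, as an object of the category of modules. -/
abbrev powQuot (t : ℕ) : ModuleCat.{u} R := ModuleCat.of R (R ⧸ I ^ t)

/-- The canonical projection `R ⧸ I ^ s ⟶ R ⧸ I ^ t` for `t ≤ s`. -/
def powQuotMap {t s : ℕ} (h : t ≤ s) : powQuot I s ⟶ powQuot I t :=
  ModuleCat.ofHom (Submodule.mapQ _ _ LinearMap.id (Ideal.pow_le_pow_right h))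

/-- A presentation of `L` as the filtered colimit of the modules `Ext^i(R ⧸ I ^ t, N)`. -/
structure ExtPowColimit (i : ℕ) (N : ModuleCat.{u} R) (L : Type u) [AddCommGroup L]
    [Module R L] where
  /-- The maps to the colimit. -/
  ι (t : ℕ) : Abelian.Ext (powQuot I t) N i →ₗ[R] L
  ι_comp {t s : ℕ} (h : t ≤ s) (x : Abelian.Ext (powQuot I t) N i) :
    ι s ((Ext.mk₀ (powQuotMap I h)).comp x (zero_add i)) = ι t x
  exists_rep (y : L) : ∃ t x, ι t x = y
  exists_comp_eq_zero (t : ℕ) (x : Abelian.Ext (powQuot I t) N i) (hx : ι t x = 0) :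
    ∃ (s : ℕ) (h : t ≤ s), (Ext.mk₀ (powQuotMap I h)).comp x (zero_add i) = 0

namespace ExtPowColimit

variable {I}

/-- Dimension shifting for presentations as colimits of `Ext` modules. -/
def shift {T : ShortComplex (ModuleCat.{u} R)} (hT : T.ShortExact) [Injective T.X₂] {i : ℕ}
    {L' L : Type u} [AddCommGroup L'] [Module R L'] [AddCommGroup L] [Module R L]
    (D : ExtPowColimit I i T.X₃ L') (π : L' →ₗ[R] L) (hπ : Function.Surjective π)
    (h₁ : ∀ t (x : Abelian.Ext (powQuot I t) T.X₃ i), x.comp hT.extClass rfl = 0 → π (D.ι t x) = 0)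
    (h₂ : ∀ t (x : Abelian.Ext (powQuot I t) T.X₃ i), π (D.ι t x) = 0 →
      ∃ (s : ℕ) (h : t ≤ s),
        ((Ext.mk₀ (powQuotMap I h)).comp x (zero_add i)).comp hT.extClass rfl = 0) :
    ExtPowColimit I (i + 1) T.X₁ L :=
  have hδ (t : ℕ) : Function.Surjective
      (Ext.postcompOfLinear hT.extClass R (powQuot I t) (rfl : i + 1 = i + 1)) := fun x =>
    Ext.covariant_sequence_exact₁ _ hT x (Ext.eq_zero_of_injective _) rfl
  have hker (t : ℕ) : LinearMap.ker
      (Ext.postcompOfLinear hT.extClass R (powQuot I t) (rfl : i + 1 = i + 1)) ≤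
        LinearMap.ker (π ∘ₗ D.ι t) := fun x hx => h₁ t x hx
  { ι t := LinearMap.descend _ (hδ t) _ (hker t)
    ι_comp {t s} h x := by
      obtain ⟨x, rfl⟩ := hδ t x
      have : (Ext.mk₀ (powQuotMap I h)).comp
          (Ext.postcompOfLinear hT.extClass R (powQuot I t) rfl x) (zero_add (i + 1)) =
          Ext.postcompOfLinear hT.extClass R (powQuot I s) rfl
            ((Ext.mk₀ (powQuotMap I h)).comp x (zero_add i)) :=
        (Ext.comp_assoc _ _ _ _ rfl (by lia)).symm
      rw [this, LinearMap.descend_apply _ (hδ s) _ (hker s),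
        LinearMap.descend_apply _ (hδ t) _ (hker t), LinearMap.comp_apply,
        LinearMap.comp_apply, D.ι_comp]
    exists_rep y := by
      obtain ⟨y, rfl⟩ := hπ y
      obtain ⟨t, x, rfl⟩ := D.exists_rep y
      exact ⟨t, _, LinearMap.descend_apply _ (hδ t) _ (hker t) x⟩
    exists_comp_eq_zero t x hx := by
      obtain ⟨x, rfl⟩ := hδ t x
      rw [LinearMap.descend_apply _ (hδ t) _ (hker t)] at hx
      obtain ⟨s, h, hs⟩ := h₂ t x hx
      exact ⟨s, h, (Ext.comp_assoc _ _ _ _ rfl (by lia)).symm.trans hs⟩ }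

/-- For positive `i`, dimension shifting does not change the colimit. -/
def succ {T : ShortComplex (ModuleCat.{u} R)} (hT : T.ShortExact) [Injective T.X₂] {i : ℕ}
    {L : Type u} [AddCommGroup L] [Module R L] (D : ExtPowColimit I (i + 1) T.X₃ L) :
    ExtPowColimit I (i + 2) T.X₁ L :=
  D.shift hT LinearMap.id Function.surjective_id
    (fun t x hx => by
      obtain ⟨y, rfl⟩ := Ext.covariant_sequence_exact₃ _ hT x rfl hx
      rw [Ext.eq_zero_of_injective y, Ext.zero_comp, map_zero, map_zero])
    (fun t x hx => by
      obtain ⟨s, h, hs⟩ := D.exists_comp_eq_zero t x hx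
      exact ⟨s, h, by rw [hs, Ext.zero_comp]⟩)

lemma apply_one_mem (t : ℕ) {N : ModuleCat.{u} R} (f : powQuot I t ⟶ N) :
    f.hom (1 : R ⧸ I ^ t) ∈ powTorsion I N := by
  refine ⟨t, fun a ha => ?_⟩
  rw [← map_smul]
  have : a • (1 : R ⧸ I ^ t) = 0 := by
    rw [Algebra.smul_def, mul_one]
    exact Ideal.Quotient.eq_zero_iff_mem.2 ha
  rw [this, map_zero]

/-- The evaluation at `1`, with values in the power torsion. -/
def evalOne (t : ℕ) (N : ModuleCat.{u} R) :
    Abelian.Ext (powQuot I t) N 0 →ₗ[R] powTorsion I N :=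
  LinearMap.codRestrict _
    (LinearMap.applyₗ (1 : R ⧸ I ^ t) ∘ₗ (Ext.linearEquiv₀.trans ModuleCat.homLinearEquiv :
        Abelian.Ext (powQuot I t) N 0 ≃ₗ[R] (R ⧸ I ^ t →ₗ[R] N)).toLinearMap)
    (fun _ => apply_one_mem t _)

lemma coe_evalOne_mk₀ {t : ℕ} {N : ModuleCat.{u} R} (f : powQuot I t ⟶ N) :
    (evalOne t N (Ext.mk₀ f) : N) = f.hom (1 : R ⧸ I ^ t) := by
  have : Ext.linearEquiv₀ (R := R) (Ext.mk₀ f) = f := Ext.linearEquiv₀.apply_symm_apply f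
  exact congrArg (fun k : powQuot I t ⟶ N => k.hom (1 : R ⧸ I ^ t)) this

lemma evalOne_injective (t : ℕ) (N : ModuleCat.{u} R) :
    Function.Injective (evalOne (I := I) t N) := by
  rw [injective_iff_map_eq_zero]
  intro x hx
  obtain ⟨f, rfl⟩ := (Ext.linearEquiv₀ (R := R)).symm.surjective x
  rw [Ext.linearEquiv₀_symm_apply] at hx ⊢
  have h : f.hom (1 : R ⧸ I ^ t) = 0 := by rw [← coe_evalOne_mk₀, hx]; rfl
  have : f = 0 := by
    refine ModuleCat.hom_ext (LinearMap.ext fun y => ?_)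
    obtain ⟨r, rfl⟩ := Ideal.Quotient.mk_surjective y
    have : (Ideal.Quotient.mk (I ^ t) r) = r • (1 : R ⧸ I ^ t) := by
      rw [Algebra.smul_def, mul_one]; rfl
    rw [this, map_smul, h, smul_zero]
    rfl
  rw [this, Ext.mk₀_zero]

/-- In degree zero, the colimit is the power torsion. -/
def zero (N : ModuleCat.{u} R) : ExtPowColimit I 0 N (powTorsion I N) where
  ι t := evalOne t N
  ι_comp {t s} h x := by
    obtain ⟨f, rfl⟩ := (Ext.linearEquiv₀ (R := R)).symm.surjective x
    ext
    rw [Ext.linearEquiv₀_symm_apply, Ext.mk₀_comp_mk₀, coe_evalOne_mk₀, coe_evalOne_mk₀]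
    rfl
  exists_rep := by
    rintro ⟨y, t, ht⟩
    refine ⟨t, Ext.mk₀ (ModuleCat.ofHom
      ((I ^ t).liftQ (LinearMap.toSpanSingleton R N y) fun a ha => ht a ha)), ?_⟩
    ext
    rw [coe_evalOne_mk₀]
    exact one_smul R y
  exists_comp_eq_zero t x hx :=
    ⟨t, le_rfl, by rw [(injective_iff_map_eq_zero _).1 (evalOne_injective t N) x hx, Ext.comp_zero]⟩

/-- In degree one, the colimit is the cokernel of a map between power torsion modules. -/
def one {T : ShortComplex (ModuleCat.{u} R)} (hT : T.ShortExact) [Injective T.X₂] :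
    ExtPowColimit I 1 T.X₁
      (powTorsion I T.X₃ ⧸ LinearMap.range (powTorsionMap I T.g.hom)) :=
  (zero T.X₃).shift hT (Submodule.mkQ _) (Submodule.mkQ_surjective _)
    (fun t x hx => by
      obtain ⟨y, rfl⟩ := Ext.covariant_sequence_exact₃ _ hT x rfl hx
      obtain ⟨f, rfl⟩ := (Ext.linearEquiv₀ (R := R)).symm.surjective y
      rw [Submodule.mkQ_apply, Submodule.Quotient.mk_eq_zero, Ext.linearEquiv₀_symm_apply,
        Ext.mk₀_comp_mk₀]
      refine ⟨evalOne t _ (Ext.mk₀ f), ?_⟩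
      ext
      refine Eq.trans ?_ (coe_evalOne_mk₀ _).symm
      rw [coe_powTorsionMap, coe_evalOne_mk₀]
      rfl)
    (fun t x hx => by
      rw [Submodule.mkQ_apply, Submodule.Quotient.mk_eq_zero] at hx
      obtain ⟨y, hy⟩ := hx
      obtain ⟨s, z, rfl⟩ := (zero T.X₂).exists_rep y
      obtain ⟨f, rfl⟩ := (Ext.linearEquiv₀ (R := R)).symm.surjective z
      refine ⟨max t s, le_max_left t s, ?_⟩
      have : (Ext.mk₀ (powQuotMap I (le_max_left t s))).comp x (zero_add 0) =
          (Ext.mk₀ (powQuotMap I (le_max_right t s) ≫ f)).comp (Ext.mk₀ T.g) (zero_add 0) := by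
        refine evalOne_injective (max t s) T.X₃
          (((zero T.X₃).ι_comp _ x).trans (hy.symm.trans ?_))
        ext
        rw [Ext.mk₀_comp_mk₀, coe_evalOne_mk₀, coe_powTorsionMap, Ext.linearEquiv₀_symm_apply]
        refine (congrArg T.g.hom (coe_evalOne_mk₀ f)).trans ?_
        rfl
      rw [this, Ext.comp_assoc _ _ _ _ (zero_add 1) (by lia), hT.comp_extClass, Ext.comp_zero])

end ExtPowColimit
end ExtPowColimit

section LocalCohomologyEquiv
open Abelian Limits
variable {R : Type u} [CommRing R] (I : Ideal R)

namespace ExtPowColimit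
variable {I} {i : ℕ} {N : ModuleCat.{u} R} {L : Type u} [AddCommGroup L] [Module R L]

/-- The diagram of `Ext` modules whose colimit is the local cohomology of `N`. -/
abbrev diagramAt (I : Ideal R) (i : ℕ) (N : ModuleCat.{u} R) : ℕᵒᵖᵒᵖ ⥤ ModuleCat.{u} R :=
  localCohomology.diagram (localCohomology.idealPowersDiagram I) i ⋙ (evaluation _ _).obj N

/-- The comparison of the two `Ext` modules in the diagram computing local cohomology. -/
def diagramAtEquiv (I : Ideal R) (i : ℕ) (N : ModuleCat.{u} R) (t : ℕᵒᵖᵒᵖ) :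
    (diagramAt I i N).obj t ≃ₗ[R] Abelian.Ext (powQuot I t.unop.unop) N i :=
  (projectiveResolution (powQuot I t.unop.unop)).extComparison N i

lemma diagramAtEquiv_map {t s : ℕᵒᵖᵒᵖ} (w : t ⟶ s) (x : (diagramAt I i N).obj t) :
    diagramAtEquiv I i N s ((diagramAt I i N).map w x) =
      (Ext.mk₀ (powQuotMap I w.unop.unop.le)).comp (diagramAtEquiv I i N t x) (zero_add i) :=
  ProjectiveResolution.extComparison_naturality _ _ _ i x

/-- The cocone on the diagram of `Ext` modules given by a presentation of `L`. -/
def cocone (D : ExtPowColimit I i N L) : Cocone (diagramAt I i N) where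
  pt := ModuleCat.of R L
  ι :=
    { app t := ModuleCat.ofHom (D.ι t.unop.unop ∘ₗ (diagramAtEquiv I i N t).toLinearMap)
      naturality t s w := by
        refine ModuleCat.hom_ext (LinearMap.ext fun x => ?_)
        exact (congrArg (D.ι s.unop.unop) (diagramAtEquiv_map w x)).trans (D.ι_comp _ _) }

/-- The colimit cocone defining local cohomology, evaluated at `N`. -/
def colimitCocone (I : Ideal R) (i : ℕ) (N : ModuleCat.{u} R) : Cocone (diagramAt I i N) :=
  ((evaluation _ _).obj N).mapCocone
    (colimit.cocone (localCohomology.diagram (localCohomology.idealPowersDiagram I) i))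

/-- The colimit cocone defining local cohomology, evaluated at `N`, is a colimit cocone. -/
def colimitCoconeIsColimit (I : Ideal R) (i : ℕ) (N : ModuleCat.{u} R) :
    IsColimit (colimitCocone I i N) :=
  isColimitOfPreserves _ (colimit.isColimit _)

instance : PreservesColimit (diagramAt I i N) (forget (ModuleCat.{u} R)) :=
  have := preservesSmallestFilteredColimits_of_preservesFilteredColimits
    (forget (ModuleCat.{u} R))
  inferInstance

lemma desc_bijective (D : ExtPowColimit I i N L) :
    Function.Bijective ((colimitCoconeIsColimit I i N).desc D.cocone).hom := by
  set c := colimitCocone I i N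
  set hc := colimitCoconeIsColimit I i N
  have fac (t : ℕᵒᵖᵒᵖ) (x : (diagramAt I i N).obj t) :
      (hc.desc D.cocone).hom ((c.ι.app t).hom x) = D.ι t.unop.unop (diagramAtEquiv I i N t x) :=
    congrArg (fun k => k.hom x) (hc.fac D.cocone t)
  constructor
  · rw [injective_iff_map_eq_zero]
    intro z hz
    obtain ⟨t, x, rfl⟩ := Concrete.isColimit_exists_rep _ hc z
    have hx := (fac t x).symm.trans hz
    obtain ⟨s, h, hs⟩ := D.exists_comp_eq_zero _ _ hx
    let w : t ⟶ Opposite.op (Opposite.op s) := (homOfLE h).op.op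
    have : (diagramAt I i N).map w x = 0 := by
      apply (diagramAtEquiv I i N _).injective
      rw [diagramAtEquiv_map, map_zero]
      exact hs
    have hw := congrArg (fun k => k.hom x) (c.w w)
    refine hw.symm.trans ?_
    exact (congrArg (c.ι.app _).hom this).trans (map_zero _)
  · intro y
    obtain ⟨t, x, rfl⟩ := D.exists_rep y
    refine ⟨(c.ι.app (Opposite.op (Opposite.op t))).hom
      ((diagramAtEquiv I i N (Opposite.op (Opposite.op t))).symm x), ?_⟩
    rw [fac, LinearEquiv.apply_symm_apply]

/-- A module presented as a colimit of `Ext` modules is the local cohomology. -/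
def equivLocalCohomology (D : ExtPowColimit I i N L) :
    (localCohomology I i).obj N ≃ₗ[R] L :=
  LinearEquiv.ofBijective _ D.desc_bijective

end ExtPowColimit
end LocalCohomologyEquiv

section ExtFiniteness
open Abelian
variable {R : Type u} [CommRing R]

lemma isNoetherian_of_ker_le_range {A B C : Type*} [AddCommGroup A] [Module R A]
    [AddCommGroup B] [Module R B] [AddCommGroup C] [Module R C] (f : A →ₗ[R] B) (g : B →ₗ[R] C)
    (hfg : LinearMap.ker g ≤ LinearMap.range f) (hf : IsNoetherian R (LinearMap.range f))
    (hC : IsNoetherian R C) : IsNoetherian R B := by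
  have : IsNoetherian R (LinearMap.ker g) := isNoetherian_of_le hfg
  exact isNoetherian_of_range_eq_ker (LinearMap.ker g).subtype g (by simp)

lemma isNoetherian_range_of_ker_le {A B C : Type*} [AddCommGroup A] [Module R A]
    [AddCommGroup B] [Module R B] [AddCommGroup C] [Module R C] (f : A →ₗ[R] B) (g : A →ₗ[R] C)
    (hgf : LinearMap.ker g ≤ LinearMap.ker f) (hC : IsNoetherian R C) :
    IsNoetherian R (LinearMap.range f) := by
  have : IsNoetherian R (A ⧸ LinearMap.ker g) :=
    isNoetherian_of_linearEquiv g.quotKerEquivRange.symm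
  have h : LinearMap.range f = LinearMap.range ((LinearMap.ker g).liftQ f hgf) :=
    (Submodule.range_liftQ _ _ _).symm
  rw [h]
  infer_instance

section LongExact

variable (X : ModuleCat.{u} R) {T : ShortComplex (ModuleCat.{u} R)} (hT : T.ShortExact) {j : ℕ}
include hT

lemma isNoetherian_ext_X₂ (h₁ : IsNoetherian R (Abelian.Ext X T.X₁ j))
    (h₃ : IsNoetherian R (Abelian.Ext X T.X₃ j)) : IsNoetherian R (Abelian.Ext X T.X₂ j) :=
  isNoetherian_of_ker_le_range
    (Ext.postcompOfLinear (Ext.mk₀ T.f) R X (add_zero j))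
    (Ext.postcompOfLinear (Ext.mk₀ T.g) R X (add_zero j))
    (fun x hx => Ext.covariant_sequence_exact₂ X hT x hx) inferInstance h₃

lemma isNoetherian_ext_X₃ (h₂ : IsNoetherian R (Abelian.Ext X T.X₂ j))
    (h₁ : IsNoetherian R (Abelian.Ext X T.X₁ (j + 1))) : IsNoetherian R (Abelian.Ext X T.X₃ j) :=
  isNoetherian_of_ker_le_range
    (Ext.postcompOfLinear (Ext.mk₀ T.g) R X (add_zero j))
    (Ext.postcompOfLinear hT.extClass R X rfl)
    (fun x hx => Ext.covariant_sequence_exact₃ X hT x rfl hx) inferInstance h₁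

lemma isNoetherian_ext_X₁ (h₃ : IsNoetherian R (Abelian.Ext X T.X₃ j))
    (h₂ : IsNoetherian R (Abelian.Ext X T.X₂ (j + 1))) :
    IsNoetherian R (Abelian.Ext X T.X₁ (j + 1)) :=
  isNoetherian_of_ker_le_range
    (Ext.postcompOfLinear hT.extClass R X rfl)
    (Ext.postcompOfLinear (Ext.mk₀ T.f) R X (add_zero (j + 1)))
    (fun x hx => Ext.covariant_sequence_exact₁ X hT x hx rfl) inferInstance h₂

end LongExact

lemma isNoetherian_ext_of_injective (X E : ModuleCat.{u} R) [Injective E] (j : ℕ) :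
    IsNoetherian R (Abelian.Ext X E (j + 1)) :=
  have := Ext.subsingleton_of_injective X E j
  inferInstance

/-- The short complex attached to a submodule. -/
abbrev submoduleShortComplex {N : Type u} [AddCommGroup N] [Module R N] (P : Submodule R N) :
    ShortComplex (ModuleCat.{u} R) :=
  ModuleCat.shortComplexOfCompEqZero P.subtype P.mkQ (by ext x; simp)

lemma submoduleShortComplex_shortExact {N : Type u} [AddCommGroup N] [Module R N]
    (P : Submodule R N) : (submoduleShortComplex P).ShortExact :=
  ModuleCat.shortComplex_shortExact _ (LinearMap.exact_subtype_mkQ P) P.injective_subtype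
    P.mkQ_surjective

variable (I : Ideal R)

variable {I} in
lemma smul_quotient_eq_zero {a : R} (ha : a ∈ I) (z : R ⧸ I) : a • z = 0 := by
  rw [Algebra.smul_def, Ideal.Quotient.algebraMap_eq, Ideal.Quotient.eq_zero_iff_mem.2 ha, zero_mul]

/-- The module `Ext^j(R ⧸ I, N)` is Noetherian. -/
def IsExtNoetherian (N : Type u) [AddCommGroup N] [Module R N] (j : ℕ) : Prop :=
  IsNoetherian R (Abelian.Ext (ModuleCat.of R (R ⧸ I)) (ModuleCat.of R N) j)

section Torsion

variable {I} {T : ShortComplex (ModuleCat.{u} R)} (hT : T.ShortExact)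

/-- The power torsion of a short exact sequence, truncated on the right. -/
abbrev torsionShortComplex (I : Ideal R) (T : ShortComplex (ModuleCat.{u} R)) :
    ShortComplex (ModuleCat.{u} R) :=
  ModuleCat.shortComplexOfCompEqZero (powTorsionMap I T.f.hom)
    (powTorsionMap I T.g.hom).rangeRestrict (by
      ext x
      exact congrArg (fun k => k.hom (x : T.X₁)) T.zero)

include hT

lemma torsionShortComplex_shortExact : (torsionShortComplex I T).ShortExact := by
  have hf : Function.Injective T.f.hom := (ModuleCat.mono_iff_injective _).1 hT.mono_f
  have hexact := (ShortComplex.ShortExact.moduleCat_exact_iff_function_exact T).1 hT.exact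
  refine ModuleCat.shortComplex_shortExact _ ?_ ?_ (LinearMap.surjective_rangeRestrict _)
  · intro x
    constructor
    · intro hx
      have hx' : T.g.hom (x : T.X₂) = 0 := congrArg (fun k => ((k.1 : powTorsion I T.X₃) : T.X₃)) hx
      obtain ⟨y, hy⟩ := (hexact (x : T.X₂)).1 hx'
      have hyt : y ∈ powTorsion I T.X₁ := by
        obtain ⟨n, hn⟩ := x.2
        refine ⟨n, fun a ha => hf ?_⟩
        rw [map_smul, map_zero]
        exact (congrArg (a • ·) hy).trans (hn a ha)
      exact ⟨⟨y, hyt⟩, Subtype.ext hy⟩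
    · rintro ⟨y, rfl⟩
      exact congrArg (fun k => k.hom y) (torsionShortComplex I T).zero
  · intro x y hxy
    exact Subtype.ext (hf (congrArg Subtype.val hxy))

variable [IsNoetherianRing R] [Injective T.X₂] {j : ℕ}

omit hT in
lemma injective_torsionShortComplex_X₂ : Injective (torsionShortComplex I T).X₂ := by
  have := Module.injective_module_of_injective_object R T.X₂
  have := injective_powTorsion I T.X₂
  exact Module.injective_object_of_injective_module R (powTorsion I T.X₂)

lemma isExtNoetherian_range (h : IsExtNoetherian I (powTorsion I T.X₁) (j + 2)) :
    IsExtNoetherian I (LinearMap.range (powTorsionMap I T.g.hom)) (j + 1) :=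
  have := injective_torsionShortComplex_X₂ (I := I) (T := T)
  isNoetherian_ext_X₃ _ (torsionShortComplex_shortExact (I := I) hT)
    (isNoetherian_ext_of_injective _ _ _) h

lemma isExtNoetherian_powTorsion_X₃ (h₁ : IsExtNoetherian I (powTorsion I T.X₁) (j + 2))
    (h : IsExtNoetherian I (powTorsion I T.X₃ ⧸ LinearMap.range (powTorsionMap I T.g.hom))
      (j + 1)) :
    IsExtNoetherian I (powTorsion I T.X₃) (j + 1) :=
  isNoetherian_ext_X₂ _ (submoduleShortComplex_shortExact _) (isExtNoetherian_range hT h₁) h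

lemma isExtNoetherian_powTorsion_X₁ (h₃ : IsExtNoetherian I (powTorsion I T.X₃) (j + 1))
    (h : IsExtNoetherian I (powTorsion I T.X₃ ⧸ LinearMap.range (powTorsionMap I T.g.hom)) j) :
    IsExtNoetherian I (powTorsion I T.X₁) (j + 2) :=
  have := injective_torsionShortComplex_X₂ (I := I) (T := T)
  isNoetherian_ext_X₁ _ (torsionShortComplex_shortExact (I := I) hT)
    (isNoetherian_ext_X₁ _ (submoduleShortComplex_shortExact _) h h₃)
    (isNoetherian_ext_of_injective _ _ _)

lemma isExtNoetherian_quotient_succ (h₃ : IsExtNoetherian I (powTorsion I T.X₃) (j + 1))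
    (h₁ : IsExtNoetherian I (powTorsion I T.X₁) (j + 3)) :
    IsExtNoetherian I (powTorsion I T.X₃ ⧸ LinearMap.range (powTorsionMap I T.g.hom)) (j + 1) :=
  isNoetherian_ext_X₃ _ (submoduleShortComplex_shortExact _) h₃ (isExtNoetherian_range hT h₁)

lemma isExtNoetherian_quotient_zero (h : IsExtNoetherian I T.X₁ 1)
    (h₁ : IsExtNoetherian I (powTorsion I T.X₁) 2) :
    IsExtNoetherian I (powTorsion I T.X₃ ⧸ LinearMap.range (powTorsionMap I T.g.hom)) 0 := by
  have hS := submoduleShortComplex_shortExact (LinearMap.range (powTorsionMap I T.g.hom))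
  refine isNoetherian_of_ker_le_range
    (Ext.postcompOfLinear (Ext.mk₀ (submoduleShortComplex _).g) R _ (add_zero 0))
    (Ext.postcompOfLinear hS.extClass R _ rfl)
    (fun x hx => Ext.covariant_sequence_exact₃ _ hS x rfl hx) ?_ (isExtNoetherian_range hT h₁)
  refine isNoetherian_range_of_ker_le _
    (Ext.postcompOfLinear hT.extClass R _ rfl ∘ₗ
      Ext.postcompOfLinear (Ext.mk₀ (ModuleCat.ofHom (powTorsion I T.X₃).subtype)) R _
        (add_zero 0)) (fun x hx => ?_) h
  obtain ⟨f, rfl⟩ := (Ext.linearEquiv₀ (R := R)).symm.surjective x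
  obtain ⟨y, hy⟩ := Ext.covariant_sequence_exact₃ _ hT _ rfl hx
  obtain ⟨k, rfl⟩ := (Ext.linearEquiv₀ (R := R)).symm.surjective y
  have hkf : k ≫ T.g = f ≫ ModuleCat.ofHom (powTorsion I T.X₃).subtype :=
    (Ext.linearEquiv₀ (R := R)).symm.injective
      ((Ext.mk₀_comp_mk₀ k T.g).symm.trans (hy.trans (Ext.mk₀_comp_mk₀ f _)))
  have hf : f ≫ (submoduleShortComplex (LinearMap.range (powTorsionMap I T.g.hom))).g = 0 := by
    refine ModuleCat.hom_ext (LinearMap.ext fun z => ?_)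
    refine (Submodule.Quotient.mk_eq_zero _).2 ⟨⟨k.hom z, 1, fun a ha => ?_⟩, Subtype.ext ?_⟩
    · rw [← map_smul, smul_quotient_eq_zero (by simpa using ha), map_zero]
    · exact congrArg (fun l => l.hom z) hkf
  exact (Ext.mk₀_comp_mk₀ f _).trans ((congrArg Ext.mk₀ hf).trans (Ext.mk₀_zero _ _))

end Torsion

lemma isExtNoetherian_powTorsion_one [IsNoetherianRing R] (N : Type u) [AddCommGroup N]
    [Module R N] (h : IsExtNoetherian I N 1) : IsExtNoetherian I (powTorsion I N) 1 := by
  refine isNoetherian_ext_X₁ _ (submoduleShortComplex_shortExact (powTorsion I N)) ?_ h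
  have : Subsingleton (Abelian.Ext (ModuleCat.of R (R ⧸ I))
      (ModuleCat.of R (N ⧸ powTorsion I N)) 0) := by
    refine (Ext.linearEquiv₀ (R := R)).toEquiv.subsingleton_congr.2
      (subsingleton_of_forall_eq 0 fun f => ?_)
    refine ModuleCat.hom_ext (LinearMap.ext fun z => ?_)
    obtain ⟨x, hx⟩ := (powTorsion I N).mkQ_surjective (f.hom z)
    refine hx.symm.trans ((Submodule.Quotient.mk_eq_zero _).2
      (mem_powTorsion_of_smul_mem I (IsNoetherian.noetherian I) fun a ha => ?_))
    rw [← Submodule.Quotient.mk_eq_zero, Submodule.Quotient.mk_smul, ← Submodule.mkQ_apply, hx,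
      ← map_smul, smul_quotient_eq_zero ha, map_zero]
  infer_instance

end ExtFiniteness

section Cosyzygy
open Abelian Limits
variable {R : Type u} [CommRing R] (I : Ideal R)

/-- The short complex embedding a module into an injective one. -/
abbrev injectiveShortComplex (N : ModuleCat.{u} R) : ShortComplex (ModuleCat.{u} R) :=
  ShortComplex.mk (Injective.ι N) (cokernel.π _) (cokernel.condition _)

lemma injectiveShortComplex_shortExact (N : ModuleCat.{u} R) :
    (injectiveShortComplex N).ShortExact where
  exact := ShortComplex.exact_cokernel _

/-- The iterated cosyzygies of a module. -/
def cosyzygy : ModuleCat.{u} R → ℕ → ModuleCat.{u} R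
  | N, 0 => N
  | N, i + 1 => cosyzygy (injectiveShortComplex N).X₃ i

lemma cosyzygy_succ (N : ModuleCat.{u} R) (i : ℕ) :
    cosyzygy N (i + 1) = (injectiveShortComplex (cosyzygy N i)).X₃ := by
  induction i generalizing N with
  | zero => rfl
  | succ i ih => exact ih (injectiveShortComplex N).X₃

/-- The cokernel of the map on power torsion induced by an injective embedding and its cokernel. -/
abbrev torsionCokernel (N : ModuleCat.{u} R) : Type u :=
  powTorsion I (injectiveShortComplex N).X₃ ⧸
    LinearMap.range (powTorsionMap I (injectiveShortComplex N).g.hom)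

/-- Positive degree local cohomology in terms of cosyzygies. -/
def extPowColimitSucc : ∀ (i : ℕ) (N : ModuleCat.{u} R),
    ExtPowColimit I (i + 1) N (torsionCokernel I (cosyzygy N i))
  | 0, N => ExtPowColimit.one (injectiveShortComplex_shortExact N)
  | i + 1, N => (extPowColimitSucc i (injectiveShortComplex N).X₃).succ
      (injectiveShortComplex_shortExact N)

lemma IsExtNoetherian.of_linearEquiv {N N' : Type u} [AddCommGroup N] [Module R N]
    [AddCommGroup N'] [Module R N'] (e : N ≃ₗ[R] N') {j : ℕ} (h : IsExtNoetherian I N j) :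
    IsExtNoetherian I N' j := by
  have : IsNoetherian R (Abelian.Ext (ModuleCat.of R (R ⧸ I)) (ModuleCat.of R N) j) := h
  refine isNoetherian_of_surjective
    (Ext.postcompOfLinear (Ext.mk₀ e.toModuleIso.hom) R _ (add_zero j))
    (LinearMap.range_eq_top.2 fun x => ⟨x.comp (Ext.mk₀ e.toModuleIso.inv) (add_zero j), ?_⟩)
  refine (Ext.comp_assoc _ _ _ _ (add_zero 0) (by lia)).trans ?_
  rw [Ext.mk₀_comp_mk₀, Iso.inv_hom_id, Ext.comp_mk₀_id]

lemma isCofinite_iff [IsNoetherianRing R] (N : ModuleCat.{u} R) (hN : ∀ x : N, x ∈ powTorsion I N) :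
    IsCofinite R I N ↔ ∀ j, IsExtNoetherian I N j := by
  refine ⟨fun h j => ?_,
    fun h => ⟨support_subset_zeroLocus_of_forall_mem_powTorsion I hN, fun j => ?_⟩⟩
  · have := h.2 j
    have := isNoetherian_of_isNoetherianRing_of_finite R
      (((_root_.Ext R (ModuleCat.{u} R) j).obj (Opposite.op (ModuleCat.of R (R ⧸ I)))).obj N)
    exact isNoetherian_of_linearEquiv ((projectiveResolution _).extComparison N j)
  · have : IsNoetherian R (Abelian.Ext (ModuleCat.of R (R ⧸ I)) N j) := h j
    exact Module.Finite.equiv ((projectiveResolution _).extComparison N j).symm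

variable {I} in
lemma ExtPowColimit.isCofinite_iff [IsNoetherianRing R] {i : ℕ} {N : ModuleCat.{u} R} {L : Type u}
    [AddCommGroup L] [Module R L] (D : ExtPowColimit I i N L)
    (hL : ∀ x : L, x ∈ powTorsion I L) :
    IsCofinite R I ((localCohomology I i).obj N) ↔ ∀ j, IsExtNoetherian I L j := by
  have e := D.equivLocalCohomology
  refine (_root_.isCofinite_iff I _ fun x => ?_).trans
    (forall_congr' fun j => ⟨.of_linearEquiv I e, .of_linearEquiv I e.symm⟩)
  simpa using map_mem_powTorsion I e.symm.toLinearMap (hL (e x))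

lemma mem_powTorsion_powTorsion {N : Type*} [AddCommGroup N] [Module R N] (x : powTorsion I N) :
    x ∈ powTorsion I (powTorsion I N) := by
  obtain ⟨n, hn⟩ := x.2
  exact ⟨n, fun a ha => Subtype.ext (hn a ha)⟩

lemma mem_powTorsion_torsionCokernel (N : ModuleCat.{u} R) (x : torsionCokernel I N) :
    x ∈ powTorsion I (torsionCokernel I N) := by
  obtain ⟨y, rfl⟩ := Submodule.mkQ_surjective _ x
  exact map_mem_powTorsion I _ (mem_powTorsion_powTorsion I y)

variable [IsNoetherianRing R]

lemma isExtNoetherian_of_finite (N : Type u) [AddCommGroup N] [Module R N] [Module.Finite R N]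
    (j : ℕ) : IsExtNoetherian I N j :=
  isNoetherian_of_isNoetherianRing_of_finite R _

variable (N : ModuleCat.{u} R)

omit [IsNoetherianRing R] in
lemma isExtNoetherian_cosyzygy (hN : ∀ j, IsExtNoetherian I N (j + 1)) (i j : ℕ) :
    IsExtNoetherian I (cosyzygy N i) (j + 1) := by
  induction i generalizing j with
  | zero => exact hN j
  | succ i ih =>
    rw [cosyzygy_succ]
    exact isNoetherian_ext_X₃ _ (injectiveShortComplex_shortExact _)
      (isNoetherian_ext_of_injective _ _ _) (ih (j + 1))

variable {I N} in
theorem isExtNoetherian_torsionCokernel (hN : ∀ j, IsExtNoetherian I N (j + 1))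
    (hN' : ∀ j, IsExtNoetherian I (powTorsion I N) (j + 1)) (m : ℕ)
    (h : ∀ i ≠ m, ∀ j, IsExtNoetherian I (torsionCokernel I (cosyzygy N i)) j) (j : ℕ) :
    IsExtNoetherian I (torsionCokernel I (cosyzygy N m)) j := by
  have ascending (i : ℕ) (hi : i ≤ m) (j : ℕ) :
      IsExtNoetherian I (powTorsion I (cosyzygy N i)) (j + 1) := by
    induction i generalizing j with
    | zero => exact hN' j
    | succ i ih =>
      rw [cosyzygy_succ]
      exact isExtNoetherian_powTorsion_X₃ (injectiveShortComplex_shortExact _)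
        (ih (by lia) (j + 1)) (h i (by lia) (j + 1))
  have descending (j i : ℕ) (hi : m < i) :
      IsExtNoetherian I (powTorsion I (cosyzygy N i)) (j + 1) := by
    induction j generalizing i with
    | zero => exact isExtNoetherian_powTorsion_one I _ (isExtNoetherian_cosyzygy I N hN i 0)
    | succ j ih =>
      have := ih (i + 1) (by lia)
      rw [cosyzygy_succ] at this
      exact isExtNoetherian_powTorsion_X₁ (injectiveShortComplex_shortExact _) this
        (h i (by lia) j)
  cases j with
  | zero =>
    exact isExtNoetherian_quotient_zero (injectiveShortComplex_shortExact _)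
      (isExtNoetherian_cosyzygy I N hN m 0) (ascending m le_rfl 1)
  | succ j =>
    have := descending j (m + 1) (Nat.lt_succ_self m)
    rw [cosyzygy_succ] at this
    exact isExtNoetherian_quotient_succ (injectiveShortComplex_shortExact _) this
      (ascending m le_rfl (j + 2))

end Cosyzygy

theorem stmt4 (R : Type u) [CommRing R] [IsNoetherianRing R] (I : Ideal R)
    (M : Type u) [AddCommGroup M] [Module R M] [Module.Finite R M] (h : ℕ)
    (hcof : ∀ i : ℕ, i ≠ h → IsCofinite R I ((localCohomology I i).obj (ModuleCat.of R M))) :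
    ∀ i : ℕ, IsCofinite R I ((localCohomology I i).obj (ModuleCat.of R M)) := by
  intro i
  rcases i with _ | m
  · exact ((ExtPowColimit.zero _).isCofinite_iff (mem_powTorsion_powTorsion I)).2
      fun j => isExtNoetherian_of_finite I (powTorsion I M) j
  have hiff (m : ℕ) := (extPowColimitSucc I m (ModuleCat.of R M)).isCofinite_iff
    (mem_powTorsion_torsionCokernel I _)
  rcases ne_or_eq (m + 1) h with hm | rfl
  · exact hcof _ hm
  exact (hiff m).2 (isExtNoetherian_torsionCokernel
    (fun j => isExtNoetherian_of_finite I M (j + 1))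
    (fun j => isExtNoetherian_of_finite I (powTorsion I M) (j + 1)) m
    fun i hi => (hiff i).1 (hcof _ (by simpa using hi)))
end
end
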